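/- arXiv:2602.11229 — 3 statements merged into one kernel-verified Lean document; each statement's English description precedes it below -/
import Mathlib

section
/- Fix ε ∈ (0,1). Let x, x* : [0, 1−ε] → E solve x'(t) = v_θ(x(t), t) and x*'(t) = v*(x*(t), t) with identical initial condition x(0) = x*(0). Assume the scaled residual regularity and ideal field stabilization hypotheses with functions L_r(t) ≥ 0 and m(t) ≥ 0, and assume t ↦ (L_r(t)+m(t))/(1−t) and t ↦ ‖r(x*(t),t)‖ are continuous on [0, 1−ε]. Then ‖x(1−ε) − x*(1−ε)‖ ≤ ε · exp(∫₀^{1−ε} (L_r(t)+m(t))/(1−t) dt) · ∫₀^{1−ε} ‖(1−t)·r(x*(t),t)‖ / (ε(1−t)) dt. -/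
open scoped RealInnerProductSpace

theorem cont_extend_aux {T : ℝ} (hT : 0 ≤ T) {f : ℝ → ℝ} (hf : ContinuousOn f (Set.Icc 0 T)) :
    ∃ g : ℝ → ℝ, Continuous g ∧ ∀ t ∈ Set.Icc (0 : ℝ) T, g t = f t := by
  refine ⟨Set.IccExtend hT ((Set.Icc (0 : ℝ) T).restrict f), ?_, ?_⟩
  · exact (continuousOn_iff_continuous_restrict.mp hf).Icc_extend'
  · intro t ht
    rw [Set.IccExtend_of_mem hT _ ht]
    rfl

theorem norm_le_integral_aux {E : Type*} [NormedAddCommGroup E] [InnerProductSpace ℝ E]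
    {T : ℝ} (hT : 0 ≤ T) (w w' : ℝ → E) (g : ℝ → ℝ) (hg : Continuous g)
    (hg0 : ∀ t ∈ Set.Icc (0 : ℝ) T, 0 ≤ g t)
    (hw : ∀ t ∈ Set.Icc (0 : ℝ) T, HasDerivAt w (w' t) t)
    (hin : ∀ t ∈ Set.Icc (0 : ℝ) T, ⟪w t, w' t⟫ ≤ g t * ‖w t‖)
    (h0 : w 0 = 0) : ‖w T‖ ≤ ∫ t in (0 : ℝ)..T, g t := by
  refine le_of_forall_pos_le_add fun δ hδ => ?_
  have hpos : ∀ t, 0 < ‖w t‖ ^ 2 + δ ^ 2 := fun t => by positivity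
  have hd : ∀ t ∈ Set.Icc (0 : ℝ) T,
      HasDerivAt (fun t => Real.sqrt (‖w t‖ ^ 2 + δ ^ 2) - ∫ s in (0 : ℝ)..t, g s)
        (2 * ⟪w t, w' t⟫ / (2 * Real.sqrt (‖w t‖ ^ 2 + δ ^ 2)) - g t) t := by
    intro t ht
    have h1 := ((hw t ht).norm_sq.add_const (δ ^ 2)).sqrt (hpos t).ne'
    exact h1.sub (hg.integral_hasStrictDerivAt 0 t).hasDerivAt
  have hanti : AntitoneOn (fun t => Real.sqrt (‖w t‖ ^ 2 + δ ^ 2) - ∫ s in (0 : ℝ)..t, g s)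
      (Set.Icc 0 T) := by
    refine antitoneOn_of_deriv_nonpos (convex_Icc 0 T)
      (fun t ht => (hd t ht).continuousAt.continuousWithinAt)
      (fun t ht => (hd t (interior_subset ht)).differentiableAt.differentiableWithinAt) ?_
    intro t ht
    have ht := interior_subset ht
    rw [(hd t ht).deriv, sub_nonpos]
    have hs : 0 < Real.sqrt (‖w t‖ ^ 2 + δ ^ 2) := Real.sqrt_pos.mpr (hpos t)
    rw [div_le_iff₀ (by positivity)]
    have h2 : ‖w t‖ ≤ Real.sqrt (‖w t‖ ^ 2 + δ ^ 2) :=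
      Real.le_sqrt_of_sq_le (by nlinarith [sq_nonneg δ])
    have h3 := mul_le_mul_of_nonneg_left h2 (hg0 t ht)
    linarith [hin t ht]
  have h := hanti (Set.left_mem_Icc.mpr hT) (Set.right_mem_Icc.mpr hT) hT
  simp only [h0, norm_zero, intervalIntegral.integral_same] at h
  have h4 : Real.sqrt ((0 : ℝ) ^ 2 + δ ^ 2) = δ := by
    simp [Real.sqrt_sq hδ.le]
  rw [h4] at h
  have h5 : ‖w T‖ ≤ Real.sqrt (‖w T‖ ^ 2 + δ ^ 2) :=
    Real.le_sqrt_of_sq_le (by nlinarith [sq_nonneg δ])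
  linarith

/-- Rescaled Gronwall bound (one-step probability-flow deviation, with
stabilization exponent `m`): if `x` and `x*` solve the PF-ODEs driven by the
learned field `v_θ` and the ideal field `v*` respectively with identical
initial condition, the scaled residual `(1−t)·r(·,t)` is `L_r(t)`-Lipschitz,
and the ideal field satisfies the one-sided stabilization bound with exponent
`m(t)`, then
`‖x(1−ε) − x*(1−ε)‖ ≤ ε · exp(∫₀^{1−ε} (L_r(t)+m(t))/(1−t) dt)
    · ∫₀^{1−ε} ‖(1−t)·r(x*(t),t)‖ / (ε(1−t)) dt`,
where `r(u,t) = v_θ(u,t) − v*(u,t)`. -/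
theorem rescaled_gronwall_bound
    {E : Type*} [NormedAddCommGroup E] [InnerProductSpace ℝ E]
    (ε : ℝ) (hε0 : 0 < ε) (hε1 : ε < 1)
    (vθ vstar : E → ℝ → E)
    (Lr m : ℝ → ℝ)
    (hLr_nonneg : ∀ t ∈ Set.Icc (0 : ℝ) (1 - ε), 0 ≤ Lr t)
    (hm_nonneg : ∀ t ∈ Set.Icc (0 : ℝ) (1 - ε), 0 ≤ m t)
    (hresid : ∀ u w : E, ∀ t ∈ Set.Icc (0 : ℝ) (1 - ε),
      ‖(1 - t) • ((vθ u t - vstar u t) - (vθ w t - vstar w t))‖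
        ≤ Lr t * ‖u - w‖)
    (hstab : ∀ u w : E, ∀ t ∈ Set.Icc (0 : ℝ) (1 - ε),
      ⟪u - w, vstar u t - vstar w t⟫
        ≤ -((1 - m t) / (1 - t)) * ‖u - w‖ ^ 2)
    (x xstar : ℝ → E)
    (hx : ∀ t ∈ Set.Icc (0 : ℝ) (1 - ε), HasDerivAt x (vθ (x t) t) t)
    (hxstar : ∀ t ∈ Set.Icc (0 : ℝ) (1 - ε),
      HasDerivAt xstar (vstar (xstar t) t) t)
    (h0 : x 0 = xstar 0)
    (hcont1 : ContinuousOn (fun t => (Lr t + m t) / (1 - t))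
      (Set.Icc (0 : ℝ) (1 - ε)))
    (hcont2 : ContinuousOn (fun t => ‖vθ (xstar t) t - vstar (xstar t) t‖)
      (Set.Icc (0 : ℝ) (1 - ε))) :
    ‖x (1 - ε) - xstar (1 - ε)‖
      ≤ ε * Real.exp (∫ t in (0 : ℝ)..(1 - ε), (Lr t + m t) / (1 - t))
          * ∫ t in (0 : ℝ)..(1 - ε),
              ‖(1 - t) • (vθ (xstar t) t - vstar (xstar t) t)‖
                / (ε * (1 - t)) := by
  have hT : 0 ≤ 1 - ε := by linarith
  obtain ⟨a, ha, hae⟩ := cont_extend_aux hT hcont1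
  obtain ⟨ρ, hρ, hρe⟩ := cont_extend_aux hT hcont2
  have hI1 : (∫ t in (0 : ℝ)..(1 - ε), (Lr t + m t) / (1 - t)) = ∫ t in (0 : ℝ)..(1 - ε), a t := by
    refine intervalIntegral.integral_congr fun t ht => ?_
    rw [Set.uIcc_of_le hT] at ht
    exact (hae t ht).symm
  have hI2 : (∫ t in (0 : ℝ)..(1 - ε), ‖(1 - t) • (vθ (xstar t) t - vstar (xstar t) t)‖
                / (ε * (1 - t))) = ∫ t in (0 : ℝ)..(1 - ε), ρ t / ε := by
    refine intervalIntegral.integral_congr fun t ht => ?_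
    rw [Set.uIcc_of_le hT] at ht
    have h1 : 0 < 1 - t := by linarith [ht.2]
    simp only [hρe t ht, norm_smul, Real.norm_of_nonneg h1.le]
    field_simp
  rw [hI1, hI2]
  let A : ℝ → ℝ := fun t => ∫ s in (0 : ℝ)..t, a s
  have hA : ∀ t, HasDerivAt A (a t) t := fun t => (ha.integral_hasStrictDerivAt 0 t).hasDerivAt
  have hA0 : ∀ t ∈ Set.Icc (0 : ℝ) (1 - ε), 0 ≤ A t := by
    intro t ht
    refine intervalIntegral.integral_nonneg ht.1 fun s hs => ?_
    have hs' : s ∈ Set.Icc (0 : ℝ) (1 - ε) := ⟨hs.1, hs.2.trans ht.2⟩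
    rw [hae s hs']
    have := hLr_nonneg s hs'
    have := hm_nonneg s hs'
    have : 0 ≤ 1 - s := by linarith [hs'.2]
    positivity
  let c : ℝ → ℝ := fun t => Real.exp (-A t) / (1 - t)
  have hc : ∀ t ∈ Set.Icc (0 : ℝ) (1 - ε), HasDerivAt c (c t * (1 / (1 - t) - a t)) t := by
    intro t ht
    have h1 : 1 - t ≠ 0 := by linarith [ht.2]
    have h2 := (hA t).neg.exp.div ((hasDerivAt_id t).const_sub 1) h1
    refine h2.congr_deriv ?_
    simp only [c, id, Pi.neg_apply]
    field_simp
    ring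
  have key := norm_le_integral_aux hT (fun t => c t • (x t - xstar t))
    (fun t => c t • (vθ (x t) t - vstar (xstar t) t)
      + (c t * (1 / (1 - t) - a t)) • (x t - xstar t)) (fun t => ρ t / ε) (by fun_prop)
    (fun t ht => by rw [hρe t ht]; positivity)
    (fun t ht => (hc t ht).smul ((hx t ht).sub (hxstar t ht))) ?_ (by simp [h0])
  · have hcT : c (1 - ε) = Real.exp (-A (1 - ε)) / ε := by simp [c]
    simp only [norm_smul, hcT] at key
    rw [Real.norm_of_nonneg (by positivity), Real.exp_neg] at key
    have hA' : (∫ t in (0 : ℝ)..(1 - ε), a t) = A (1 - ε) := rfl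
    rw [hA']
    have he := Real.exp_pos (A (1 - ε))
    calc ‖x (1 - ε) - xstar (1 - ε)‖
        = ε * Real.exp (A (1 - ε)) *
          ((Real.exp (A (1 - ε)))⁻¹ / ε * ‖x (1 - ε) - xstar (1 - ε)‖) := by
          field_simp
      _ ≤ _ := mul_le_mul_of_nonneg_left key (by positivity)
  · intro t ht
    have h1 : 0 < 1 - t := by linarith [ht.2]
    have hcpos : 0 < c t := div_pos (Real.exp_pos _) h1
    have hcle : c t ≤ 1 / ε := by
      refine div_le_div₀ zero_le_one ?_ hε0 (by linarith [ht.2])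
      exact Real.exp_le_one_iff.mpr (by linarith [hA0 t ht])
    have hat := hae t ht
    have hρt := hρe t ht
    have hst := hstab (x t) (xstar t) t ht
    have hre := hresid (x t) (xstar t) t ht
    have hdec : vθ (x t) t - vstar (xstar t) t = (vstar (x t) t - vstar (xstar t) t)
        + ((vθ (x t) t - vstar (x t) t) - (vθ (xstar t) t - vstar (xstar t) t))
        + (vθ (xstar t) t - vstar (xstar t) t) := by abel
    rw [norm_smul, Real.norm_of_nonneg h1.le] at hre
    set e := x t - xstar t with he
    set R := (vθ (x t) t - vstar (x t) t) - (vθ (xstar t) t - vstar (xstar t) t) with hR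
    have hRle : ‖R‖ ≤ Lr t / (1 - t) * ‖e‖ := by
      rw [div_mul_eq_mul_div, le_div_iff₀ h1]; linarith
    have hi1 : ⟪e, R⟫ ≤ Lr t / (1 - t) * ‖e‖ ^ 2 := by
      have := real_inner_le_norm e R
      nlinarith [mul_le_mul_of_nonneg_left hRle (norm_nonneg e)]
    have hi2 : ⟪e, vθ (xstar t) t - vstar (xstar t) t⟫ ≤ ‖e‖ * ρ t := by
      rw [hρt]; exact real_inner_le_norm _ _
    have hi : ⟪e, vθ (x t) t - vstar (xstar t) t⟫ ≤ (a t - 1 / (1 - t)) * ‖e‖ ^ 2 + ‖e‖ * ρ t := by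
      rw [hdec, inner_add_right, inner_add_right]
      have h5 : (a t - 1 / (1 - t)) * ‖e‖ ^ 2
          = -((1 - m t) / (1 - t)) * ‖e‖ ^ 2 + Lr t / (1 - t) * ‖e‖ ^ 2 := by
        rw [hat]; ring
      rw [h5]
      linarith
    have hρ0 : 0 ≤ ρ t := by rw [hρt]; positivity
    simp only [inner_add_right, real_inner_smul_left, real_inner_smul_right,
      real_inner_self_eq_norm_sq, norm_smul, Real.norm_of_nonneg hcpos.le]
    have h6 := mul_le_mul_of_nonneg_left hi (mul_pos hcpos hcpos).le
    have h7 : c t * (ρ t * (c t * ‖e‖)) ≤ 1 / ε * (ρ t * (c t * ‖e‖)) :=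
      mul_le_mul_of_nonneg_right hcle (by positivity)
    have h8 : ρ t / ε * (c t * ‖e‖) = 1 / ε * (ρ t * (c t * ‖e‖)) := by ring
    rw [h8]
    linarith
end

section
/- Fix ε ∈ (0,1). Let x, x* : [0, 1−ε] → E solve x'(t) = v_θ(x(t), t) and x*'(t) = v*(x*(t), t) with identical initial condition x(0) = x*(0). Assume the scaled residual regularity hypothesis with function L_r(t) ≥ 0, assume the reference field is one-sidedly contractive, i.e., ⟨u − w, v*(u,t) − v*(w,t)⟩ ≤ −(1/(1−t))·‖u − w‖² for all u, w ∈ E and t ∈ [0,1−ε], and assume t ↦ L_r(t)/(1−t) and t ↦ ‖r(x*(t),t)‖ are continuous on [0, 1−ε]. Then, writing η(t) := (1−t)·r(x*(t),t), we have ‖x(1−ε) − x*(1−ε)‖ ≤ ε · exp(∫₀^{1−ε} L_r(t)/(1−t) dt) · ∫₀^{1−ε} ‖η(t)‖ / (ε(1−t)) dt. -/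
open scoped RealInnerProductSpace

theorem gronwall_aux {E : Type*} [NormedAddCommGroup E] [InnerProductSpace ℝ E]
    (T : ℝ) (hT : 0 ≤ T) (a g : ℝ → ℝ) (ha : Continuous a) (hg : Continuous g)
    (ha0 : ∀ t ∈ Set.Icc (0 : ℝ) T, 0 ≤ a t) (hg0 : ∀ t ∈ Set.Icc (0 : ℝ) T, 0 ≤ g t)
    (e e' : ℝ → E) (he : ∀ t ∈ Set.Icc (0 : ℝ) T, HasDerivAt e (e' t) t)
    (h0 : e 0 = 0)
    (hin : ∀ t ∈ Set.Icc (0 : ℝ) T, ⟪e t, e' t⟫ ≤ a t * ‖e t‖ ^ 2 + g t * ‖e t‖) :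
    ‖e T‖ ≤ Real.exp (∫ t in (0 : ℝ)..T, a t) * ∫ t in (0 : ℝ)..T, g t := by
  have key : ∀ δ : ℝ, 0 < δ →
      ‖e T‖ ≤ Real.exp (∫ t in (0 : ℝ)..T, a t) * ((∫ t in (0 : ℝ)..T, g t) + δ) := by
    intro δ hδ
    let A : ℝ → ℝ := fun s => ∫ t in (0 : ℝ)..s, a t
    let G : ℝ → ℝ := fun s => ∫ t in (0 : ℝ)..s, g t
    have hA : ∀ s, HasDerivAt A (a s) s := fun s => ha.integral_hasStrictDerivAt 0 s |>.hasDerivAt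
    have hG : ∀ s, HasDerivAt G (g s) s := fun s => hg.integral_hasStrictDerivAt 0 s |>.hasDerivAt
    let φ : ℝ → ℝ := fun s => Real.sqrt (‖e s‖ ^ 2 + δ ^ 2)
    have hpos : ∀ s, 0 < ‖e s‖ ^ 2 + δ ^ 2 := fun s => by positivity
    have hφpos : ∀ s, 0 < φ s := fun s => Real.sqrt_pos.2 (hpos s)
    have hφ : ∀ s ∈ Set.Icc (0 : ℝ) T, HasDerivAt φ (2 * ⟪e s, e' s⟫ / (2 * φ s)) s :=
      fun s hs => (((he s hs).norm_sq).add_const (δ ^ 2)).sqrt (hpos s).ne'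
    have hF : ∀ s ∈ Set.Icc (0 : ℝ) T, HasDerivAt (fun s => φ s * Real.exp (-A s) - G s)
        ((2 * ⟪e s, e' s⟫ / (2 * φ s)) * Real.exp (-A s)
          + φ s * (Real.exp (-A s) * (-a s)) - g s) s :=
      fun s hs => ((hφ s hs).mul ((hA s).neg.exp)).sub (hG s)
    have hA0 : ∀ s ∈ Set.Icc (0 : ℝ) T, 0 ≤ A s := fun s hs =>
      intervalIntegral.integral_nonneg hs.1 fun u hu => ha0 u ⟨hu.1, hu.2.trans hs.2⟩
    have hanti : AntitoneOn (fun s => φ s * Real.exp (-A s) - G s) (Set.Icc 0 T) := by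
      apply antitoneOn_of_deriv_nonpos (convex_Icc 0 T)
      · exact fun s hs => (hF s hs).continuousAt.continuousWithinAt
      · exact fun s hs => (hF s (interior_subset hs)).differentiableAt.differentiableWithinAt
      · intro s hs
        have hs := interior_subset hs
        rw [(hF s hs).deriv]
        have hsq : φ s ^ 2 = ‖e s‖ ^ 2 + δ ^ 2 := Real.sq_sqrt (hpos s).le
        have hle : ‖e s‖ ≤ φ s := by
          apply Real.le_sqrt_of_sq_le
          nlinarith
        have h1 : 2 * ⟪e s, e' s⟫ / (2 * φ s) ≤ a s * φ s + g s := by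
          rw [div_le_iff₀ (by linarith [hφpos s])]
          have h2 := hin s hs
          have h3 : a s * ‖e s‖ ^ 2 ≤ a s * φ s ^ 2 :=
            mul_le_mul_of_nonneg_left (by nlinarith) (ha0 s hs)
          have h4 := mul_le_mul_of_nonneg_left hle (hg0 s hs)
          nlinarith
        have hexp : Real.exp (-A s) ≤ 1 := Real.exp_le_one_iff.2 (by linarith [hA0 s hs])
        have h5 := mul_le_mul_of_nonneg_right h1 (Real.exp_pos (-A s)).le
        have h6 := mul_le_mul_of_nonneg_left hexp (hg0 s hs)
        nlinarith
    have hfin := hanti (Set.left_mem_Icc.2 hT) (Set.right_mem_Icc.2 hT) hT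
    have hφ0 : φ 0 = δ := by simp [φ, h0, Real.sqrt_sq hδ.le]
    have hAz : A 0 = 0 := by simp [A]
    have hGz : G 0 = 0 := by simp [G]
    simp only [hφ0, hAz, hGz, neg_zero, Real.exp_zero, mul_one, sub_zero] at hfin
    have hleT : ‖e T‖ ≤ φ T := by
      apply Real.le_sqrt_of_sq_le
      nlinarith
    have hee : Real.exp (A T) * Real.exp (-A T) = 1 := by
      rw [← Real.exp_add]; simp
    calc ‖e T‖ ≤ φ T := hleT
      _ = Real.exp (A T) * (φ T * Real.exp (-A T)) := by
        rw [mul_left_comm, hee, mul_one]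
      _ ≤ Real.exp (A T) * (G T + δ) := by
        apply mul_le_mul_of_nonneg_left _ (Real.exp_pos _).le
        linarith
  apply le_of_forall_pos_le_add
  intro η hη
  have hE := Real.exp_pos (∫ t in (0 : ℝ)..T, a t)
  have := key (η / Real.exp (∫ t in (0 : ℝ)..T, a t)) (by positivity)
  rwa [mul_add, mul_div_cancel₀ _ hE.ne'] at this

/-- One-step probability-flow deviation bound (stabilization exponent
`m ≡ 0`): if `x` and `x*` solve the PF-ODEs driven by the learned field `v_θ`
and the reference field `v*` respectively with identical initial condition,
the scaled residual `(1−t)·r(·,t)` is `L_r(t)`-Lipschitz, and the reference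
field is one-sidedly contractive with rate `1/(1−t)`, then, with
`η(t) = (1−t)·r(x*(t),t)` and `r(u,t) = v_θ(u,t) − v*(u,t)`,
`‖x(1−ε) − x*(1−ε)‖ ≤ ε · exp(∫₀^{1−ε} L_r(t)/(1−t) dt)
    · ∫₀^{1−ε} ‖η(t)‖ / (ε(1−t)) dt`. -/
theorem one_step_probability_flow_deviation
    {E : Type*} [NormedAddCommGroup E] [InnerProductSpace ℝ E]
    (ε : ℝ) (hε0 : 0 < ε) (hε1 : ε < 1)
    (vθ vstar : E → ℝ → E)
    (Lr : ℝ → ℝ)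
    (hLr_nonneg : ∀ t ∈ Set.Icc (0 : ℝ) (1 - ε), 0 ≤ Lr t)
    (hresid : ∀ u w : E, ∀ t ∈ Set.Icc (0 : ℝ) (1 - ε),
      ‖(1 - t) • ((vθ u t - vstar u t) - (vθ w t - vstar w t))‖
        ≤ Lr t * ‖u - w‖)
    (hcontractive : ∀ u w : E, ∀ t ∈ Set.Icc (0 : ℝ) (1 - ε),
      ⟪u - w, vstar u t - vstar w t⟫ ≤ -(1 / (1 - t)) * ‖u - w‖ ^ 2)
    (x xstar : ℝ → E)
    (hx : ∀ t ∈ Set.Icc (0 : ℝ) (1 - ε), HasDerivAt x (vθ (x t) t) t)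
    (hxstar : ∀ t ∈ Set.Icc (0 : ℝ) (1 - ε),
      HasDerivAt xstar (vstar (xstar t) t) t)
    (h0 : x 0 = xstar 0)
    (hcont1 : ContinuousOn (fun t => Lr t / (1 - t))
      (Set.Icc (0 : ℝ) (1 - ε)))
    (hcont2 : ContinuousOn (fun t => ‖vθ (xstar t) t - vstar (xstar t) t‖)
      (Set.Icc (0 : ℝ) (1 - ε))) :
    ‖x (1 - ε) - xstar (1 - ε)‖
      ≤ ε * Real.exp (∫ t in (0 : ℝ)..(1 - ε), Lr t / (1 - t))
          * ∫ t in (0 : ℝ)..(1 - ε),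
              ‖(1 - t) • (vθ (xstar t) t - vstar (xstar t) t)‖
                / (ε * (1 - t)) := by
  have hT : (0 : ℝ) ≤ 1 - ε := by linarith
  have hpos : ∀ t ∈ Set.Icc (0 : ℝ) (1 - ε), 0 < 1 - t := fun t ht => by linarith [ht.2]
  let a : ℝ → ℝ := Set.IccExtend hT ((Set.Icc (0 : ℝ) (1 - ε)).domRestrict fun t => Lr t / (1 - t))
  let g : ℝ → ℝ := Set.IccExtend hT
    ((Set.Icc (0 : ℝ) (1 - ε)).domRestrict fun t => ‖vθ (xstar t) t - vstar (xstar t) t‖)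
  have ha : Continuous a := (continuousOn_iff_continuous_restrict.1 hcont1).Icc_extend'
  have hg : Continuous g := (continuousOn_iff_continuous_restrict.1 hcont2).Icc_extend'
  have haeq : ∀ t ∈ Set.Icc (0 : ℝ) (1 - ε), a t = Lr t / (1 - t) :=
    fun t ht => Set.IccExtend_of_mem hT _ ht
  have hgeq : ∀ t ∈ Set.Icc (0 : ℝ) (1 - ε), g t = ‖vθ (xstar t) t - vstar (xstar t) t‖ :=
    fun t ht => Set.IccExtend_of_mem hT _ ht
  have main := gronwall_aux (1 - ε) hT a g ha hg
    (fun t ht => by rw [haeq t ht]; exact div_nonneg (hLr_nonneg t ht) (hpos t ht).le)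
    (fun t ht => by rw [hgeq t ht]; exact norm_nonneg _)
    (fun t => x t - xstar t) (fun t => vθ (x t) t - vstar (xstar t) t)
    (fun t ht => (hx t ht).sub (hxstar t ht)) (by simp [h0])
    (by
      intro t ht
      rw [haeq t ht, hgeq t ht]
      have hp := hpos t ht
      have hc := hcontractive (x t) (xstar t) t ht
      have hc0 : 0 ≤ 1 / (1 - t) * ‖x t - xstar t‖ ^ 2 := by positivity
      have hr := hresid (x t) (xstar t) t ht
      rw [norm_smul, Real.norm_of_nonneg hp.le] at hr
      have hr' : ‖(vθ (x t) t - vstar (x t) t) - (vθ (xstar t) t - vstar (xstar t) t)‖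
          ≤ Lr t / (1 - t) * ‖x t - xstar t‖ := by
        rw [div_mul_eq_mul_div, le_div_iff₀ hp]; linarith
      have hdec : vθ (x t) t - vstar (xstar t) t = (vstar (x t) t - vstar (xstar t) t)
          + ((vθ (x t) t - vstar (x t) t) - (vθ (xstar t) t - vstar (xstar t) t))
          + (vθ (xstar t) t - vstar (xstar t) t) := by abel
      rw [hdec, inner_add_right, inner_add_right]
      have i1 := real_inner_le_norm (x t - xstar t)
        ((vθ (x t) t - vstar (x t) t) - (vθ (xstar t) t - vstar (xstar t) t))
      have i2 := real_inner_le_norm (x t - xstar t) (vθ (xstar t) t - vstar (xstar t) t)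
      have i3 := mul_le_mul_of_nonneg_left hr' (norm_nonneg (x t - xstar t))
      nlinarith)
  have e1 : ∫ t in (0 : ℝ)..(1 - ε), a t = ∫ t in (0 : ℝ)..(1 - ε), Lr t / (1 - t) :=
    intervalIntegral.integral_congr fun t ht => haeq t (by rwa [Set.uIcc_of_le hT] at ht)
  have e2 : ∫ t in (0 : ℝ)..(1 - ε), ‖(1 - t) • (vθ (xstar t) t - vstar (xstar t) t)‖
      / (ε * (1 - t)) = ∫ t in (0 : ℝ)..(1 - ε), ε⁻¹ * g t :=
    intervalIntegral.integral_congr fun t ht => by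
      rw [Set.uIcc_of_le hT] at ht
      have hp := hpos t ht
      simp only [hgeq t ht, norm_smul, Real.norm_of_nonneg hp.le]
      field_simp
  rw [e2, intervalIntegral.integral_const_mul, ← e1]
  calc _ ≤ _ := main
    _ = _ := by field_simp
end

section
/- Fix ε ∈ (0,1) and t₀ ∈ [0, 1−ε]. Under the hypotheses of the rescaled Gronwall setting, define Δ(t) := x(t) − x*(t) and y(t) := (1−t)⁻¹·Δ(t). Suppose Δ has derivative Δ'(t₀) = v_θ(x(t₀), t₀) − v*(x*(t₀), t₀) at t₀, so that y has derivative y'(t₀) = (1−t₀)⁻¹·Δ'(t₀) + (1−t₀)⁻²·Δ(t₀) at t₀. Then ⟨y(t₀), y'(t₀)⟩ ≤ ((L_r(t₀) + m(t₀))/(1−t₀))·‖y(t₀)‖² + ‖y(t₀)‖·‖r(x*(t₀), t₀)‖/(1−t₀). -/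
open scoped RealInnerProductSpace

/-- Key differential inequality for the rescaled deviation: under the
rescaled-Gronwall hypotheses (scaled residual regularity with constant
`L_r(t)` and ideal-field stabilization with exponent `m(t)`), with
`Δ(t) = x(t) − x*(t)` and `y(t) = (1−t)⁻¹·Δ(t)`, if at `t₀` the deviation has
derivative `Δ'(t₀) = v_θ(x(t₀),t₀) − v*(x*(t₀),t₀)` and hence `y` has
derivative `y'(t₀) = (1−t₀)⁻¹·Δ'(t₀) + (1−t₀)⁻²·Δ(t₀)`, then
`⟨y(t₀), y'(t₀)⟩ ≤ ((L_r(t₀)+m(t₀))/(1−t₀))·‖y(t₀)‖²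
    + ‖y(t₀)‖·‖r(x*(t₀),t₀)‖/(1−t₀)`,
where `r(u,t) = v_θ(u,t) − v*(u,t)`. -/
theorem rescaled_deviation_differential_inequality
    {E : Type*} [NormedAddCommGroup E] [InnerProductSpace ℝ E]
    (ε : ℝ) (hε0 : 0 < ε) (hε1 : ε < 1)
    (t₀ : ℝ) (ht₀ : t₀ ∈ Set.Icc (0 : ℝ) (1 - ε))
    (vθ vstar : E → ℝ → E)
    (Lr m : ℝ → ℝ)
    (hLr_nonneg : ∀ t ∈ Set.Icc (0 : ℝ) (1 - ε), 0 ≤ Lr t)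
    (hm_nonneg : ∀ t ∈ Set.Icc (0 : ℝ) (1 - ε), 0 ≤ m t)
    (hresid : ∀ u w : E, ∀ t ∈ Set.Icc (0 : ℝ) (1 - ε),
      ‖(1 - t) • ((vθ u t - vstar u t) - (vθ w t - vstar w t))‖
        ≤ Lr t * ‖u - w‖)
    (hstab : ∀ u w : E, ∀ t ∈ Set.Icc (0 : ℝ) (1 - ε),
      ⟪u - w, vstar u t - vstar w t⟫
        ≤ -((1 - m t) / (1 - t)) * ‖u - w‖ ^ 2)
    (x xstar : ℝ → E)
    (hx : ∀ t ∈ Set.Icc (0 : ℝ) (1 - ε), HasDerivAt x (vθ (x t) t) t)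
    (hxstar : ∀ t ∈ Set.Icc (0 : ℝ) (1 - ε),
      HasDerivAt xstar (vstar (xstar t) t) t)
    (hΔ' : HasDerivAt (fun t => x t - xstar t)
      (vθ (x t₀) t₀ - vstar (xstar t₀) t₀) t₀)
    (hy' : HasDerivAt (fun t => (1 - t)⁻¹ • (x t - xstar t))
      ((1 - t₀)⁻¹ • (vθ (x t₀) t₀ - vstar (xstar t₀) t₀)
        + ((1 - t₀) ^ 2)⁻¹ • (x t₀ - xstar t₀)) t₀) :
    ⟪(1 - t₀)⁻¹ • (x t₀ - xstar t₀),
        (1 - t₀)⁻¹ • (vθ (x t₀) t₀ - vstar (xstar t₀) t₀)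
          + ((1 - t₀) ^ 2)⁻¹ • (x t₀ - xstar t₀)⟫
      ≤ ((Lr t₀ + m t₀) / (1 - t₀)) * ‖(1 - t₀)⁻¹ • (x t₀ - xstar t₀)‖ ^ 2
          + ‖(1 - t₀)⁻¹ • (x t₀ - xstar t₀)‖
              * ‖vθ (xstar t₀) t₀ - vstar (xstar t₀) t₀‖ / (1 - t₀) := by
  have hs : 0 < 1 - t₀ := by linarith [ht₀.2]
  have h1 := hstab (x t₀) (xstar t₀) t₀ ht₀
  have h2 := hresid (x t₀) (xstar t₀) t₀ ht₀
  have hdec : vθ (x t₀) t₀ - vstar (xstar t₀) t₀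
      = (vstar (x t₀) t₀ - vstar (xstar t₀) t₀)
        + ((vθ (x t₀) t₀ - vstar (x t₀) t₀) - (vθ (xstar t₀) t₀ - vstar (xstar t₀) t₀))
        + (vθ (xstar t₀) t₀ - vstar (xstar t₀) t₀) := by abel
  rw [hdec]
  generalize (vθ (x t₀) t₀ - vstar (x t₀) t₀) - (vθ (xstar t₀) t₀ - vstar (xstar t₀) t₀) = B at *
  generalize vθ (xstar t₀) t₀ - vstar (xstar t₀) t₀ = C at *
  generalize vstar (x t₀) t₀ - vstar (xstar t₀) t₀ = A at *
  generalize x t₀ - xstar t₀ = d at *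
  have hk : 0 < (1 - t₀)⁻¹ := inv_pos.mpr hs
  have hsk : (1 - t₀)⁻¹ * (1 - t₀) = 1 := inv_mul_cancel₀ hs.ne'
  rw [norm_smul, Real.norm_of_nonneg hs.le] at h2
  rw [norm_smul, Real.norm_of_nonneg hk.le, inner_add_right, real_inner_smul_left,
    real_inner_smul_left, real_inner_smul_right, real_inner_smul_right, inner_add_right,
    inner_add_right, real_inner_self_eq_norm_sq, ← inv_pow]
  simp only [div_eq_mul_inv] at *
  generalize (1 - t₀)⁻¹ = k at *
  have hB : ‖B‖ ≤ k * (Lr t₀ * ‖d‖) := by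
    calc ‖B‖ = k * ((1 - t₀) * ‖B‖) := by rw [← mul_assoc, hsk, one_mul]
      _ ≤ _ := mul_le_mul_of_nonneg_left h2 hk.le
  have h3 : ⟪d, B⟫ ≤ ‖d‖ * (k * (Lr t₀ * ‖d‖)) :=
    (real_inner_le_norm d B).trans (mul_le_mul_of_nonneg_left hB (norm_nonneg _))
  have h4 := real_inner_le_norm d C
  have h5 := mul_le_mul_of_nonneg_left (add_le_add (add_le_add h1 h3) h4) (sq_nonneg k)
  linarith
end
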